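/- Let V be an sl₂-Hodge structure of weight n polarized by the hermitian pairing Q, with total Hodge filtration F and conjugate total Hodge filtration F̄. Then: (a) the subspaces V♯^{p,q} := (e^Y F)^p ∩ (e^{−Y} F̄)^q, for p + q = n, form a direct sum decomposition V = ⊕_{p+q=n} V♯^{p,q} which is a Hodge structure of weight n polarized by Q; (b) the inner product determined by this polarized Hodge structure, namely ⟨v, v'⟩♯ = Σ_{p+q=n} (−1)^q Q(v♯^{p,q}, v'♯^{p,q}) (components with respect to the decomposition in (a)), is equal to the inner product ⟨v, v'⟩ = Σ_{p,q} (−1)^q Q(v^{p,q}, w(v'^{p,q})) (components with respect to the bigrading V = ⊕ V^{p,q}, w the Weil element); (c) with respect to this inner product, H is self-adjoint and the adjoint of Y is X. -/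

import Mathlib

/-!
For a polarized sl₂-Hodge structure of weight `n` with total Hodge filtration `F` and
conjugate total Hodge filtration `F̄`:
(a) the subspaces `V♯^{p,q} = (e^Y F)^p ∩ (e^{−Y} F̄)^q` (`p+q=n`) form a Hodge structure
of weight `n` polarized by `Q`;
(b) the inner product of this polarized Hodge structure equals the inner product
`⟨v,v'⟩ = Σ (−1)^q Q(v^{p,q}, w(v'^{p,q}))` of the sl₂-Hodge structure;
(c) with respect to this inner product `H` is self-adjoint and the adjoint of `Y` is `X`.
The inner product of (a) is encoded as `(v, v') ↦ Q(v, C♯ v')`, where `C♯` is the Weil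
operator of the Hodge structure `V = ⊕ V♯^{p,q}` (acting as `(−1)^q` on `V♯^{p,q}`);
part (b) is expressed by evaluation on the spanning bigraded pieces.
-/

/-- `c : ℂ` is a positive real number. -/
def posC (c : ℂ) : Prop := c.im = 0 ∧ 0 < c.re

/-- The exponential of a nilpotent endomorphism of a finite-dimensional space. -/
noncomputable def expEnd {V : Type*} [AddCommGroup V] [Module ℂ V] [FiniteDimensional ℂ V]
    (A : V →ₗ[ℂ] V) : V →ₗ[ℂ] V :=
  ∑ k ∈ Finset.range (Module.finrank ℂ V + 1), ((k.factorial : ℂ))⁻¹ • A ^ k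

/-- The Weil element `w = e^X e^{−Y} e^X`. -/
noncomputable def weil {V : Type*} [AddCommGroup V] [Module ℂ V] [FiniteDimensional ℂ V]
    (X Y : V →ₗ[ℂ] V) : V →ₗ[ℂ] V :=
  expEnd X ∘ₗ expEnd (-Y) ∘ₗ expEnd X

/-- The total Hodge filtration `F^p = ⊕_{i ≥ p, j} V^{i,j}` of a bigrading. -/
def totalF {V : Type*} [AddCommGroup V] [Module ℂ V]
    (Vb : ℤ → ℤ → Submodule ℂ V) (p : ℤ) : Submodule ℂ V :=
  ⨆ i : ℤ, ⨆ (_ : p ≤ i), ⨆ j : ℤ, Vb i j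

/-- The conjugate total Hodge filtration `F̄^q = ⊕_{j ≥ q, i} V^{i,j}` of a bigrading. -/
def totalFbar {V : Type*} [AddCommGroup V] [Module ℂ V]
    (Vb : ℤ → ℤ → Submodule ℂ V) (q : ℤ) : Submodule ℂ V :=
  ⨆ j : ℤ, ⨆ (_ : q ≤ j), ⨆ i : ℤ, Vb i j

/-- The subspace `V♯^{p, n−p} = (e^Y F)^p ∩ (e^{−Y} F̄)^{n−p}`. -/
noncomputable def Vsharp {V : Type*} [AddCommGroup V] [Module ℂ V] [FiniteDimensional ℂ V]
    (n : ℤ) (Y : V →ₗ[ℂ] V) (Vb : ℤ → ℤ → Submodule ℂ V) (p : ℤ) : Submodule ℂ V :=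
  Submodule.map (expEnd Y) (totalF Vb p) ⊓
    Submodule.map (expEnd (-Y)) (totalFbar Vb (n - p))

section Exponential

variable {V : Type*} [AddCommGroup V] [Module ℂ V] [FiniteDimensional ℂ V]

theorem pow_finrank_eq_zero_of_isNilpotent {A : Module.End ℂ V} (hA : IsNilpotent A) :
    A ^ Module.finrank ℂ V = 0 := by
  obtain ⟨m, hm⟩ := hA
  ext v
  have : v ∈ LinearMap.ker (A ^ m) := by simp [hm]
  simpa using Module.End.ker_pow_le_ker_pow_finrank A m this

theorem expEnd_eq_sum {A : Module.End ℂ V} (hA : IsNilpotent A) {N : ℕ}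
    (hN : Module.finrank ℂ V ≤ N) :
    expEnd A = ∑ k ∈ Finset.range N, ((k.factorial : ℂ))⁻¹ • A ^ k := by
  have hz : ∀ k, Module.finrank ℂ V ≤ k → A ^ k = 0 := fun k hk =>
    pow_eq_zero_of_le hk (pow_finrank_eq_zero_of_isNilpotent hA)
  have key : ∀ M, Module.finrank ℂ V ≤ M →
      ∑ k ∈ Finset.range M, ((k.factorial : ℂ))⁻¹ • A ^ k =
        ∑ k ∈ Finset.range (Module.finrank ℂ V), ((k.factorial : ℂ))⁻¹ • A ^ k := by
    intro M hM
    refine (Finset.sum_subset (Finset.range_mono hM) fun k _ hk => ?_).symm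
    rw [hz k (by simpa using hk), smul_zero]
  rw [key N hN]
  exact key _ (Nat.le_succ _)

theorem expEnd_add {A B : Module.End ℂ V} (hAB : Commute A B) (hA : IsNilpotent A)
    (hB : IsNilpotent B) : expEnd (A + B) = expEnd A * expEnd B := by
  let _ : Module ℚ V := Module.compHom V (algebraMap ℚ ℂ)
  have h : ∀ C : Module.End ℂ V, IsNilpotent C → expEnd C = IsNilpotent.exp C := by
    intro C hC
    rw [IsNilpotent.exp_eq_sum (pow_finrank_eq_zero_of_isNilpotent hC), expEnd_eq_sum hC le_rfl]
    refine Finset.sum_congr rfl fun k _ => ?_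
    ext v
    change _ = (algebraMap ℚ ℂ (k.factorial : ℚ)⁻¹) • (C ^ k) v
    simp
  rw [h _ (hAB.isNilpotent_add hA hB), h A hA, h B hB, IsNilpotent.exp_add_of_commute hAB hA hB]

theorem expEnd_smul_mul_expEnd_smul {A : Module.End ℂ V} (hA : IsNilpotent A) (a b : ℂ) :
    expEnd (a • A) * expEnd (b • A) = expEnd ((a + b) • A) := by
  rw [add_smul, expEnd_add (((Commute.refl A).smul_left a).smul_right b) (hA.smul a) (hA.smul b)]

theorem expEnd_zero : expEnd (0 : Module.End ℂ V) = 1 := by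
  have h : IsNilpotent (0 : Module.End ℂ V) := IsNilpotent.zero
  rw [expEnd_eq_sum h (Nat.le_succ _), Finset.sum_range_succ']
  simp

theorem expEnd_smul_mul_expEnd_neg_smul {A : Module.End ℂ V} (hA : IsNilpotent A) (a : ℂ) :
    expEnd (a • A) * expEnd ((-a) • A) = 1 := by
  rw [expEnd_smul_mul_expEnd_smul hA, add_neg_cancel, zero_smul, expEnd_zero]

theorem mul_expEnd_of_semiconj {M A B : Module.End ℂ V} (h : M * A = B * M) :
    M * expEnd A = expEnd B * M := by
  have hp : ∀ k : ℕ, M * A ^ k = B ^ k * M := fun k =>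
    (SemiconjBy.pow_right (show SemiconjBy M A B from h) k)
  rw [expEnd, expEnd, Finset.mul_sum, Finset.sum_mul]
  exact Finset.sum_congr rfl fun k _ => by rw [mul_smul_comm, smul_mul_assoc, hp]

/-- `e^A B = (B + [A,B] + ½ [A,[A,B]]) e^A` when `[A,[A,[A,B]]] = 0`. -/
theorem expEnd_mul {A B D E : Module.End ℂ V} (hA : IsNilpotent A)
    (hB : A * B = B * A + D) (hD : A * D = D * A + E) (hE : A * E = E * A) :
    expEnd A * B = (B + D + (1 / 2 : ℂ) • E) * expEnd A := by
  have h1 : ∀ k : ℕ, A ^ (k + 2) * B = B * A ^ (k + 2) + (k + 2 : ℂ) • (D * A ^ (k + 1))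
      + ((k + 2) * (k + 1) / 2 : ℂ) • (E * A ^ k) := by
    intro k
    induction k with
    | zero =>
      simp only [zero_add, pow_zero, pow_one, mul_one, pow_two]
      rw [mul_assoc, hB, mul_add, hD, ← mul_assoc, hB, add_mul, mul_assoc]
      push_cast
      module
    | succ k ih =>
      rw [pow_succ' A (k + 2), mul_assoc, ih]
      simp only [mul_add, mul_smul_comm, ← mul_assoc, hB, hD, hE, add_mul]
      simp only [mul_assoc, ← pow_succ']
      push_cast
      match_scalars <;> ring
  set N := Module.finrank ℂ V
  rw [add_mul, add_mul]
  nth_rewrite 4 [expEnd_eq_sum hA (le_refl N)]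
  nth_rewrite 3 [expEnd_eq_sum hA (Nat.le_succ N)]
  rw [expEnd_eq_sum hA (show N ≤ N + 2 by omega)]
  rw [Finset.sum_range_succ' _ (N + 1), Finset.sum_range_succ' _ N,
    Finset.sum_range_succ' _ N]
  simp only [add_mul _ _ B, mul_add B, mul_add D, Finset.sum_mul, Finset.mul_sum, smul_mul_assoc,
    mul_smul_comm, h1, smul_add, Finset.sum_add_distrib]
  have e1 : ∀ k : ℕ, (((k + 1 + 1).factorial : ℂ))⁻¹ • (k + 2 : ℂ) • (D * A ^ (k + 1)) =
      (((k + 1).factorial : ℂ))⁻¹ • (D * A ^ (k + 1)) := by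
    intro k
    rw [smul_smul, Nat.factorial_succ (k + 1)]
    congr 1
    have : ((k + 1).factorial : ℂ) ≠ 0 := by exact_mod_cast Nat.factorial_ne_zero _
    have h2 : (k + 2 : ℂ) ≠ 0 := by exact_mod_cast (by omega : k + 2 ≠ 0)
    push_cast
    rw [show (k + 1 + 1 : ℂ) = k + 2 by ring]
    field_simp
  have e2 : ∀ k : ℕ, (((k + 1 + 1).factorial : ℂ))⁻¹ • ((k + 2) * (k + 1) / 2 : ℂ) • (E * A ^ k) =
      ((k.factorial : ℂ))⁻¹ • (1 / 2 : ℂ) • (E * A ^ k) := by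
    intro k
    rw [smul_smul, smul_smul, Nat.factorial_succ (k + 1), Nat.factorial_succ k]
    congr 1
    have : (k.factorial : ℂ) ≠ 0 := by exact_mod_cast Nat.factorial_ne_zero _
    have h1 : (k + 1 : ℂ) ≠ 0 := by exact_mod_cast (by omega : k + 1 ≠ 0)
    have h2 : (k + 2 : ℂ) ≠ 0 := by exact_mod_cast (by omega : k + 2 ≠ 0)
    push_cast
    rw [show (k + 1 + 1 : ℂ) = k + 2 by ring]
    field_simp
  simp only [add_assoc, Nat.reduceAdd] at e1 e2 ⊢
  simp only [e1, e2]
  simp [hB]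
  abel

end Exponential

section Sl2

variable {V : Type*} [AddCommGroup V] [Module ℂ V] [FiniteDimensional ℂ V]

/-- A representation of `sl₂` by endomorphisms with `X` and `Y` nilpotent. -/
structure IsNilpotentSl2 (H X Y : Module.End ℂ V) : Prop where
  hX : X * H = H * X + (-2 : ℂ) • X
  hY : Y * H = H * Y + (2 : ℂ) • Y
  xy : X * Y = Y * X + H
  nilX : IsNilpotent X
  nilY : IsNilpotent Y

variable {H X Y : Module.End ℂ V}

namespace IsNilpotentSl2

theorem exp_X_mul_H (h : IsNilpotentSl2 H X Y) (a : ℂ) :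
    expEnd (a • X) * H = (H - (2 * a) • X) * expEnd (a • X) := by
  rw [expEnd_mul (h.nilX.smul a) (D := (-2 * a) • X) (E := 0)]
  · congr 1; module
  · rw [smul_mul_assoc, h.hX, mul_smul_comm]; module
  · simp only [smul_mul_assoc, mul_smul_comm]; module
  · simp

theorem exp_Y_mul_H (h : IsNilpotentSl2 H X Y) (b : ℂ) :
    expEnd (b • Y) * H = (H + (2 * b) • Y) * expEnd (b • Y) := by
  rw [expEnd_mul (h.nilY.smul b) (D := (2 * b) • Y) (E := 0)]
  · congr 1; module
  · rw [smul_mul_assoc, h.hY, mul_smul_comm]; module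
  · simp only [smul_mul_assoc, mul_smul_comm]; module
  · simp

theorem exp_X_mul_Y (h : IsNilpotentSl2 H X Y) (a : ℂ) :
    expEnd (a • X) * Y = (Y + a • H - (a ^ 2) • X) * expEnd (a • X) := by
  rw [expEnd_mul (h.nilX.smul a) (D := a • H) (E := (-2 * a ^ 2) • X)]
  · congr 1; module
  · rw [smul_mul_assoc, h.xy, mul_smul_comm]; module
  · simp only [smul_mul_assoc, mul_smul_comm, h.hX]; module
  · simp only [smul_mul_assoc, mul_smul_comm]; module

theorem exp_Y_mul_X (h : IsNilpotentSl2 H X Y) (b : ℂ) :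
    expEnd (b • Y) * X = (X - b • H - (b ^ 2) • Y) * expEnd (b • Y) := by
  rw [expEnd_mul (h.nilY.smul b) (D := (-b) • H) (E := (-2 * b ^ 2) • Y)]
  · congr 1; module
  · rw [smul_mul_assoc, mul_smul_comm, h.xy]; module
  · simp only [smul_mul_assoc, mul_smul_comm, h.hY]; module
  · simp only [smul_mul_assoc, mul_smul_comm]; module

theorem exp_X_mul_X (a : ℂ) : expEnd (a • X) * X = X * expEnd (a • X) :=
  (mul_expEnd_of_semiconj (by simp)).symm

theorem reflection_mul_H (h : IsNilpotentSl2 H X Y) {c : ℂ} (hc : c ≠ 0) :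
    (expEnd (c • Y) * expEnd ((-c⁻¹) • X) * expEnd (c • Y)) * H =
      -(H * (expEnd (c • Y) * expEnd ((-c⁻¹) • X) * expEnd (c • Y))) := by
  have h2 : expEnd ((-c⁻¹) • X) * (H + (2 * c) • Y) =
      ((2 * c) • Y - H) * expEnd ((-c⁻¹) • X) := by
    rw [mul_add, mul_smul_comm, h.exp_X_mul_H, h.exp_X_mul_Y, ← smul_mul_assoc, ← add_mul]
    congr 1
    match_scalars <;> field_simp <;> ring
  have h3 : expEnd (c • Y) * ((2 * c) • Y - H) = -H * expEnd (c • Y) := by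
    rw [mul_sub, mul_smul_comm, h.exp_Y_mul_H, exp_X_mul_X, ← smul_mul_assoc, ← sub_mul]
    congr 1
    module
  rw [mul_assoc, h.exp_Y_mul_H, mul_assoc, ← mul_assoc (expEnd ((-c⁻¹) • X)), h2, ← mul_assoc,
    ← mul_assoc, h3]
  simp only [neg_mul, mul_assoc]

theorem weil_eq (X Y : Module.End ℂ V) :
    weil X Y = expEnd ((1 : ℂ) • X) * expEnd ((-1 : ℂ) • Y) * expEnd ((1 : ℂ) • X) := by
  rw [one_smul, neg_one_smul]; rfl

theorem weil_mul_X (h : IsNilpotentSl2 H X Y) : weil X Y * X = -(Y * weil X Y) := by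
  have h2 : expEnd ((-1 : ℂ) • Y) * X = (X + H - Y) * expEnd ((-1 : ℂ) • Y) := by
    rw [h.exp_Y_mul_X]; congr 1; module
  have h3 : expEnd ((1 : ℂ) • X) * (X + H - Y) = -Y * expEnd ((1 : ℂ) • X) := by
    rw [mul_sub, mul_add, exp_X_mul_X, h.exp_X_mul_H, h.exp_X_mul_Y, ← add_mul, ← sub_mul]
    congr 1; module
  rw [weil_eq, mul_assoc, exp_X_mul_X, mul_assoc, ← mul_assoc (expEnd ((-1 : ℂ) • Y)), h2,
    ← mul_assoc, ← mul_assoc, h3]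
  simp only [neg_mul, mul_assoc]

theorem weil_eq' (h : IsNilpotentSl2 H X Y) :
    weil X Y = expEnd ((-1 : ℂ) • Y) * expEnd ((1 : ℂ) • X) * expEnd ((-1 : ℂ) • Y) := by
  have h1 : weil X Y * expEnd ((1 : ℂ) • X) = expEnd ((-1 : ℂ) • Y) * weil X Y := by
    apply mul_expEnd_of_semiconj
    rw [one_smul, h.weil_mul_X, neg_one_smul, neg_mul]
  have h2 : expEnd ((1 : ℂ) • X) * expEnd ((-1 : ℂ) • X) = 1 :=
    expEnd_smul_mul_expEnd_neg_smul h.nilX 1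
  calc weil X Y = weil X Y * expEnd ((1 : ℂ) • X) * expEnd ((-1 : ℂ) • X) := by
        rw [mul_assoc, h2, mul_one]
    _ = _ := by
        rw [h1, weil_eq]
        simp only [mul_assoc, h2, mul_one]

/-- `e^Y e^{-X/2}` conjugates `H` to `X + Y`. -/
theorem cayley_mul_H (h : IsNilpotentSl2 H X Y) :
    (expEnd ((1 : ℂ) • Y) * expEnd ((-(1 / 2) : ℂ) • X)) * H =
      (X + Y) * (expEnd ((1 : ℂ) • Y) * expEnd ((-(1 / 2) : ℂ) • X)) := by
  rw [mul_assoc, h.exp_X_mul_H, ← mul_assoc, ← mul_assoc]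
  congr 1
  rw [mul_sub, mul_smul_comm, h.exp_Y_mul_H, h.exp_Y_mul_X, ← smul_mul_assoc, ← sub_mul]
  congr 1
  module

end IsNilpotentSl2

end Sl2

section Grading

variable {V : Type*} [AddCommGroup V] [Module ℂ V] {ι : Type*} {A : ι → Submodule ℂ V}

theorem DirectSum.IsInternal.linearMap_ext [DecidableEq ι] (hA : DirectSum.IsInternal A)
    {W : Type*} [AddCommGroup W] [Module ℂ W] {f g : V →ₗ[ℂ] W}
    (h : ∀ i, ∀ v ∈ A i, f v = g v) : f = g := by
  have : (⨆ i, A i) ≤ LinearMap.eqLocus f g := iSup_le fun i v hv => h i v hv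
  rw [hA.submodule_iSup_eq_top] at this
  exact LinearMap.ext fun v => this trivial

@[elab_as_elim]
theorem DirectSum.IsInternal.induction [DecidableEq ι] (hA : DirectSum.IsInternal A)
    {motive : V → Prop} (mem : ∀ i, ∀ v ∈ A i, motive v) (zero : motive 0)
    (add : ∀ v w, motive v → motive w → motive (v + w)) (v : V) : motive v :=
  Submodule.iSup_induction A (motive := motive) (hA.submodule_iSup_eq_top ▸ Submodule.mem_top)
    mem zero add

/-- Every function on the index set of a direct sum decomposition acts diagonally. -/
theorem DirectSum.IsInternal.exists_diagonal [DecidableEq ι] (hA : DirectSum.IsInternal A)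
    (f : ι → ℂ) : ∃ D : Module.End ℂ V, ∀ i, ∀ v ∈ A i, D v = f i • v := by
  let e := LinearEquiv.ofBijective (DirectSum.coeLinearMap A) hA
  refine ⟨DirectSum.toModule ℂ ι V (fun i => f i • (A i).subtype) ∘ₗ e.symm.toLinearMap, ?_⟩
  intro i v hv
  have : e.symm v = DirectSum.lof ℂ ι (fun i => A i) i ⟨v, hv⟩ := by
    rw [LinearEquiv.symm_apply_eq]
    exact (DirectSum.coeLinearMap_lof A i ⟨v, hv⟩).symm
  simp [this]

theorem DirectSum.IsInternal.exists_projection [DecidableEq ι] (hA : DirectSum.IsInternal A)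
    (s : Set ι) : ∃ P : Module.End ℂ V, (∀ i ∈ s, ∀ v ∈ A i, P v = v) ∧
      (∀ i ∉ s, ∀ v ∈ A i, P v = 0) ∧ (∀ v, P v ∈ ⨆ i ∈ s, A i) ∧
      ∀ v ∈ ⨆ i ∈ s, A i, P v = v := by
  classical
  obtain ⟨P, hP⟩ := hA.exists_diagonal (fun i => if i ∈ s then 1 else 0)
  have h1 : ∀ i ∈ s, ∀ v ∈ A i, P v = v := fun i hi v hv => by rw [hP i v hv]; simp [hi]
  have h0 : ∀ i ∉ s, ∀ v ∈ A i, P v = 0 := fun i hi v hv => by rw [hP i v hv]; simp [hi]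
  refine ⟨P, h1, h0, ?_, ?_⟩
  · have : (⨆ i, A i) ≤ (⨆ i ∈ s, A i).comap P := by
      refine iSup_le fun i v hv => ?_
      by_cases hi : i ∈ s
      · rw [Submodule.mem_comap, h1 i hi v hv]
        exact Submodule.mem_iSup_of_mem i (Submodule.mem_iSup_of_mem hi hv)
      · rw [Submodule.mem_comap, h0 i hi v hv]
        exact zero_mem _
    rw [hA.submodule_iSup_eq_top] at this
    exact fun v => this trivial
  · have : (⨆ i ∈ s, A i) ≤ LinearMap.eqLocus P LinearMap.id :=
      iSup₂_le fun i hi v hv => h1 i hi v hv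
    exact fun v hv => this hv

theorem DirectSum.IsInternal.biSup_inf_biSup [DecidableEq ι] (hA : DirectSum.IsInternal A)
    (s t : Set ι) : (⨆ i ∈ s, A i) ⊓ (⨆ i ∈ t, A i) = ⨆ i ∈ s ∩ t, A i := by
  apply le_antisymm
  · rintro v ⟨hs, ht⟩
    obtain ⟨P, hP1, hP0, -, hP⟩ := hA.exists_projection s
    obtain ⟨P', hP1', hP0', -, hP'⟩ := hA.exists_projection t
    obtain ⟨R, hR1, hR0, hR, -⟩ := hA.exists_projection (s ∩ t)
    have : P * P' = R := by
      refine hA.linearMap_ext fun i v hv => ?_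
      by_cases hi : i ∈ t
      · rw [Module.End.mul_apply, hP1' i hi v hv]
        by_cases hj : i ∈ s
        · rw [hP1 i hj v hv, hR1 i ⟨hj, hi⟩ v hv]
        · rw [hP0 i hj v hv, hR0 i (fun h => hj h.1) v hv]
      · rw [Module.End.mul_apply, hP0' i hi v hv, hR0 i (fun h => hi h.2) v hv, map_zero]
    have h2 : R v = v := by rw [← this, Module.End.mul_apply, hP' v ht, hP v hs]
    rw [← h2]
    exact hR v
  · exact le_inf (biSup_mono fun i hi => hi.1) (biSup_mono fun i hi => hi.2)

theorem DirectSum.IsInternal.mem_of_diagonal_eigenvector [DecidableEq ι]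
    (hA : DirectSum.IsInternal A) {D : Module.End ℂ V} {f : ι → ℂ}
    (hD : ∀ i, ∀ v ∈ A i, D v = f i • v) {c : ℂ} {u : V} (hu : D u = c • u) :
    u ∈ ⨆ i ∈ {i | f i = c}, A i := by
  obtain ⟨P, hP1, hP0, hP, -⟩ := hA.exists_projection {i | f i = c}
  obtain ⟨G, hG⟩ := hA.exists_diagonal fun i => (f i - c)⁻¹
  have key : G * (D - c • 1) = 1 - P := by
    refine hA.linearMap_ext fun i v hv => ?_
    have h1 : (G * (D - c • 1)) v = ((f i - c) * (f i - c)⁻¹) • v := by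
      simp only [Module.End.mul_apply, LinearMap.sub_apply, hD i v hv, LinearMap.smul_apply,
        Module.End.one_apply, ← sub_smul, map_smul, hG i v hv, smul_smul]
    rw [h1, LinearMap.sub_apply]
    by_cases hi : f i = c
    · rw [hP1 i hi v hv]; simp [hi]
    · rw [hP0 i hi v hv, mul_inv_cancel₀ (sub_ne_zero.2 hi)]; simp
  have h2 := LinearMap.congr_fun key u
  simp only [Module.End.mul_apply, LinearMap.sub_apply, hu, LinearMap.smul_apply,
    Module.End.one_apply, sub_self, map_zero] at h2
  rw [sub_eq_zero.1 h2.symm]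
  exact hP u

theorem map_biSup_le_biSup {M : Module.End ℂ V} {s t : Set ι}
    (h : ∀ i ∈ s, ∀ v ∈ A i, M v ∈ ⨆ j ∈ t, A j) :
    (⨆ i ∈ s, A i).map M ≤ ⨆ i ∈ t, A i := by
  rw [Submodule.map_le_iff_le_comap]
  exact iSup₂_le fun i hi v hv => h i hi v hv

end Grading

section Bigrading

variable {V : Type*} [AddCommGroup V] [Module ℂ V] {Vb : ℤ → ℤ → Submodule ℂ V}

theorem totalF_eq_biSup (p : ℤ) :
    totalF Vb p = ⨆ ij ∈ {ij : ℤ × ℤ | p ≤ ij.1}, Vb ij.1 ij.2 := by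
  refine le_antisymm (iSup_le fun i => iSup_le fun hi => iSup_le fun j => ?_)
    (iSup₂_le fun ij hij => ?_)
  · exact le_iSup₂_of_le (i, j) hi le_rfl
  · exact le_iSup_of_le ij.1 (le_iSup_of_le hij (le_iSup_of_le ij.2 le_rfl))

theorem totalFbar_eq_biSup (q : ℤ) :
    totalFbar Vb q = ⨆ ij ∈ {ij : ℤ × ℤ | q ≤ ij.2}, Vb ij.1 ij.2 := by
  refine le_antisymm (iSup_le fun j => iSup_le fun hj => iSup_le fun i => ?_)
    (iSup₂_le fun ij hij => ?_)
  · exact le_iSup₂_of_le (i, j) hj le_rfl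
  · exact le_iSup_of_le ij.2 (le_iSup_of_le hij (le_iSup_of_le ij.1 le_rfl))

variable [FiniteDimensional ℂ V]

theorem isNilpotent_of_shift (hdec : DirectSum.IsInternal (fun ij : ℤ × ℤ => Vb ij.1 ij.2))
    {A : Module.End ℂ V} {s : ℤ} (hs : s ≠ 0)
    (hA : ∀ i j : ℤ, ∀ v ∈ Vb i j, A v ∈ Vb (i + s) (j + s)) : IsNilpotent A := by
  refine ⟨Module.finrank ℂ V, hdec.linearMap_ext ?_⟩
  rintro ⟨i, j⟩ v hv
  have hpow : ∀ m : ℕ, (A ^ m) v ∈ Vb (i + m * s) (j + m * s) := by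
    intro m
    induction m with
    | zero => simpa using hv
    | succ m ih =>
      rw [pow_succ', Module.End.mul_apply]
      convert hA _ _ _ ih using 2 <;> push_cast <;> ring
  have hfin : {ij : ℤ × ℤ | Vb ij.1 ij.2 ≠ ⊥}.Finite :=
    WellFoundedGT.finite_ne_bot_of_iSupIndep hdec.submodule_iSupIndep
  obtain ⟨m, hm⟩ : ∃ m : ℕ, (A ^ m) v = 0 := by
    by_contra! hne
    have hinj : Function.Injective fun m : ℕ => ((i + m * s, j + m * s) : ℤ × ℤ) := by
      intro a b hab
      simpa [hs] using congrArg Prod.fst hab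
    refine Set.infinite_of_injective_forall_mem hinj (fun m => ?_) hfin
    exact (Submodule.ne_bot_iff _).2 ⟨_, hpow m, hne m⟩
  have : v ∈ LinearMap.ker (A ^ m) := hm
  simpa using Module.End.ker_pow_le_ker_pow_finrank A m this

theorem expEnd_mem {U : Submodule ℂ V} {A : Module.End ℂ V} (hA : ∀ v ∈ U, A v ∈ U)
    {v : V} (hv : v ∈ U) : expEnd A v ∈ U := by
  have hp : ∀ k : ℕ, (A ^ k) v ∈ U := by
    intro k
    induction k with
    | zero => simpa using hv
    | succ k ih => rw [pow_succ']; exact hA _ ih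
  rw [expEnd, LinearMap.sum_apply]
  exact sum_mem fun k _ => U.smul_mem _ (hp k)

theorem map_expEnd_smul_eq {U : Submodule ℂ V} {A : Module.End ℂ V} (hnil : IsNilpotent A)
    (hA : ∀ v ∈ U, A v ∈ U) (a : ℂ) : U.map (expEnd (a • A)) = U := by
  have hle : ∀ b : ℂ, ∀ v ∈ U, expEnd (b • A) v ∈ U := fun b v hv =>
    expEnd_mem (fun v hv => U.smul_mem b (hA v hv)) hv
  apply le_antisymm
  · rintro _ ⟨v, hv, rfl⟩
    exact hle a v hv
  · intro v hv
    refine ⟨expEnd ((-a) • A) v, hle _ v hv, ?_⟩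
    rw [← Module.End.mul_apply, expEnd_smul_mul_expEnd_neg_smul hnil, Module.End.one_apply]

end Bigrading

section BigradedSl2

variable {V : Type*} [AddCommGroup V] [Module ℂ V] [FiniteDimensional ℂ V]

/-- A representation of `sl₂` on a bigraded space, compatible with the bigrading in weight `n`. -/
structure IsSl2Bigraded (n : ℤ) (H X Y : Module.End ℂ V) (Vb : ℤ → ℤ → Submodule ℂ V) :
    Prop where
  sl2 : IsNilpotentSl2 H X Y
  dec : DirectSum.IsInternal (fun ij : ℤ × ℤ => Vb ij.1 ij.2)
  H_apply : ∀ i j : ℤ, ∀ v ∈ Vb i j, H v = ((i + j - n : ℤ) : ℂ) • v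
  X_mem : ∀ i j : ℤ, ∀ v ∈ Vb i j, X v ∈ Vb (i + 1) (j + 1)
  Y_mem : ∀ i j : ℤ, ∀ v ∈ Vb i j, Y v ∈ Vb (i - 1) (j - 1)

/-- The operator `e^Y e^{-X/2}`, carrying the `i`-grading of a bigraded `sl₂`-representation to the
decomposition into the subspaces `Vsharp`. -/
noncomputable def cayley (X Y : Module.End ℂ V) : Module.End ℂ V :=
  expEnd ((1 : ℂ) • Y) * expEnd ((-(1 / 2) : ℂ) • X)

variable {n : ℤ} {H X Y : Module.End ℂ V} {Vb : ℤ → ℤ → Submodule ℂ V}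

namespace IsSl2Bigraded

omit [FiniteDimensional ℂ V] in
theorem end_ext (h : IsSl2Bigraded n H X Y Vb) {W : Type*} [AddCommGroup W] [Module ℂ W]
    {f g : V →ₗ[ℂ] W} (hfg : ∀ i j : ℤ, ∀ v ∈ Vb i j, f v = g v) : f = g :=
  h.dec.linearMap_ext fun ij v hv => hfg ij.1 ij.2 v hv

omit [FiniteDimensional ℂ V] in
theorem commute_X (h : IsSl2Bigraded n H X Y Vb) {T : Module.End ℂ V}
    (hT : ∀ i j : ℤ, ∀ v ∈ Vb i j, T v = ((i - j : ℤ) : ℂ) • v) : T * X = X * T :=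
  h.end_ext fun i j v hv => by
    rw [Module.End.mul_apply, Module.End.mul_apply, hT _ _ _ (h.X_mem i j v hv), hT i j v hv,
      map_smul, add_sub_add_right_eq_sub]

omit [FiniteDimensional ℂ V] in
theorem commute_Y (h : IsSl2Bigraded n H X Y Vb) {T : Module.End ℂ V}
    (hT : ∀ i j : ℤ, ∀ v ∈ Vb i j, T v = ((i - j : ℤ) : ℂ) • v) : T * Y = Y * T :=
  h.end_ext fun i j v hv => by
    rw [Module.End.mul_apply, Module.End.mul_apply, hT _ _ _ (h.Y_mem i j v hv), hT i j v hv,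
      map_smul, sub_sub_sub_cancel_right]

theorem mul_exp_X (h : IsSl2Bigraded n H X Y Vb) {T : Module.End ℂ V}
    (hT : ∀ i j : ℤ, ∀ v ∈ Vb i j, T v = ((i - j : ℤ) : ℂ) • v) (a : ℂ) :
    T * expEnd (a • X) = expEnd (a • X) * T :=
  mul_expEnd_of_semiconj (by rw [mul_smul_comm, h.commute_X hT, smul_mul_assoc])

theorem mul_exp_Y (h : IsSl2Bigraded n H X Y Vb) {T : Module.End ℂ V}
    (hT : ∀ i j : ℤ, ∀ v ∈ Vb i j, T v = ((i - j : ℤ) : ℂ) • v) (a : ℂ) :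
    T * expEnd (a • Y) = expEnd (a • Y) * T :=
  mul_expEnd_of_semiconj (by rw [mul_smul_comm, h.commute_Y hT, smul_mul_assoc])

theorem reflection_mem (h : IsSl2Bigraded n H X Y Vb) {c : ℂ} (hc : c ≠ 0) {i j : ℤ} {v : V}
    (hv : v ∈ Vb i j) :
    (expEnd (c • Y) * expEnd ((-c⁻¹) • X) * expEnd (c • Y)) v ∈ Vb (n - j) (n - i) := by
  obtain ⟨T, hT'⟩ := h.dec.exists_diagonal fun ij => ((ij.1 - ij.2 : ℤ) : ℂ)
  have hT : ∀ i j : ℤ, ∀ v ∈ Vb i j, T v = ((i - j : ℤ) : ℂ) • v := fun i j => hT' (i, j)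
  set M := expEnd (c • Y) * expEnd ((-c⁻¹) • X) * expEnd (c • Y) with hM
  have hMT : T * M = M * T := by
    rw [hM, ← mul_assoc, ← mul_assoc, h.mul_exp_Y hT, mul_assoc (expEnd (c • Y)), h.mul_exp_X hT,
      mul_assoc, mul_assoc, mul_assoc, h.mul_exp_Y hT]
    simp only [mul_assoc]
  have h1 : H (M v) = (-(i + j - n : ℤ) : ℂ) • M v := by
    have hMH : M * H = -(H * M) := h.sl2.reflection_mul_H hc
    have := LinearMap.congr_fun hMH v
    rw [LinearMap.neg_apply] at this
    change M (H v) = -(H (M v)) at this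
    rw [h.H_apply i j v hv, map_smul] at this
    rw [neg_smul, this, neg_neg]
  have h2 : T (M v) = ((i - j : ℤ) : ℂ) • M v := by
    rw [← Module.End.mul_apply, hMT, Module.End.mul_apply, hT i j v hv, map_smul]
  have m1 := h.dec.mem_of_diagonal_eigenvector (fun ij => h.H_apply ij.1 ij.2) h1
  have m2 := h.dec.mem_of_diagonal_eigenvector (fun ij => hT ij.1 ij.2) h2
  have m := Submodule.mem_inf.2 ⟨m1, m2⟩
  rw [h.dec.biSup_inf_biSup] at m
  refine (iSup₂_le ?_ : _ ≤ Vb (n - j) (n - i)) m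
  rintro ⟨a, b⟩ ⟨hab, hab'⟩
  have e1 : a + b - n = -(i + j - n) := by exact_mod_cast hab
  have e2 : a - b = i - j := by exact_mod_cast hab'
  obtain rfl : a = n - j := by omega
  obtain rfl : b = n - i := by omega
  exact le_rfl

theorem weil_mem (h : IsSl2Bigraded n H X Y Vb) {i j : ℤ} {v : V} (hv : v ∈ Vb i j) :
    weil X Y v ∈ Vb (n - j) (n - i) := by
  rw [h.sl2.weil_eq']
  simpa using h.reflection_mem (c := -1) (by norm_num) hv

omit [FiniteDimensional ℂ V] in
theorem map_X_totalF (h : IsSl2Bigraded n H X Y Vb) (p : ℤ) :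
    ∀ v ∈ totalF Vb p, X v ∈ totalF Vb p := by
  rw [totalF_eq_biSup]
  intro v hv
  refine map_biSup_le_biSup (fun ij hij u hu => ?_) (Submodule.mem_map_of_mem hv)
  exact le_iSup₂_of_le (f := fun (ij : ℤ × ℤ) (_ : ij ∈ {ij : ℤ × ℤ | p ≤ ij.1}) => Vb ij.1 ij.2)
    (ij.1 + 1, ij.2 + 1) (by simp only [Set.mem_ofPred_eq] at hij ⊢; omega) le_rfl
    (h.X_mem _ _ u hu)

omit [FiniteDimensional ℂ V] in
theorem map_Y_biSup_le (h : IsSl2Bigraded n H X Y Vb) (p : ℤ) :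
    ∀ v ∈ ⨆ ij ∈ {ij : ℤ × ℤ | ij.1 ≤ p}, Vb ij.1 ij.2,
      Y v ∈ ⨆ ij ∈ {ij : ℤ × ℤ | ij.1 ≤ p}, Vb ij.1 ij.2 := by
  intro v hv
  refine map_biSup_le_biSup (fun ij hij u hu => ?_) (Submodule.mem_map_of_mem hv)
  exact le_iSup₂_of_le (f := fun (ij : ℤ × ℤ) (_ : ij ∈ {ij : ℤ × ℤ | ij.1 ≤ p}) => Vb ij.1 ij.2)
    (ij.1 - 1, ij.2 - 1) (by simp only [Set.mem_ofPred_eq] at hij ⊢; omega) le_rfl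
    (h.Y_mem _ _ u hu)

theorem reflection_mul_reflection (h : IsSl2Bigraded n H X Y Vb) (c : ℂ) :
    (expEnd (c • Y) * expEnd ((-c⁻¹) • X) * expEnd (c • Y)) *
      (expEnd ((-c) • Y) * expEnd ((-(-c)⁻¹) • X) * expEnd ((-c) • Y)) = 1 := by
  have e1 := expEnd_smul_mul_expEnd_neg_smul h.sl2.nilY c
  have e2 := expEnd_smul_mul_expEnd_neg_smul h.sl2.nilX (-c⁻¹)
  rw [show -(-c)⁻¹ = -(-c⁻¹) by rw [inv_neg]]
  calc _ = expEnd (c • Y) * (expEnd ((-c⁻¹) • X) * ((expEnd (c • Y) * expEnd ((-c) • Y)) *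
        expEnd ((-(-c⁻¹)) • X))) * expEnd ((-c) • Y) := by simp only [mul_assoc]
    _ = 1 := by rw [e1, one_mul, e2, mul_one, e1]

theorem map_reflection (h : IsSl2Bigraded n H X Y Vb) {c : ℂ} (hc : c ≠ 0) (p : ℤ) :
    (⨆ ij ∈ {ij : ℤ × ℤ | ij.1 ≤ p}, Vb ij.1 ij.2).map
      (expEnd (c • Y) * expEnd ((-c⁻¹) • X) * expEnd (c • Y)) = totalFbar Vb (n - p) := by
  rw [totalFbar_eq_biSup]
  apply le_antisymm
  · refine map_biSup_le_biSup fun ij hij u hu => ?_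
    exact le_iSup₂_of_le
      (f := fun (ij : ℤ × ℤ) (_ : ij ∈ {ij : ℤ × ℤ | n - p ≤ ij.2}) => Vb ij.1 ij.2)
      (n - ij.2, n - ij.1) (by simp only [Set.mem_ofPred_eq] at hij ⊢; omega) le_rfl
      (h.reflection_mem hc hu)
  · intro v hv
    refine ⟨(expEnd ((-c) • Y) * expEnd ((-(-c)⁻¹) • X) * expEnd ((-c) • Y)) v, ?_, ?_⟩
    · refine map_biSup_le_biSup (fun ij hij u hu => ?_) (Submodule.mem_map_of_mem hv)
      exact le_iSup₂_of_le
        (f := fun (ij : ℤ × ℤ) (_ : ij ∈ {ij : ℤ × ℤ | ij.1 ≤ p}) => Vb ij.1 ij.2)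
        (n - ij.2, n - ij.1) (by simp only [Set.mem_ofPred_eq] at hij ⊢; omega) le_rfl
        (h.reflection_mem (neg_ne_zero.2 hc) hu)
    · rw [← Module.End.mul_apply, h.reflection_mul_reflection, Module.End.one_apply]

theorem cayley_injective (h : IsSl2Bigraded n H X Y Vb) : Function.Injective (cayley X Y) := by
  have e1 := expEnd_smul_mul_expEnd_neg_smul h.sl2.nilY (-1)
  have e2 := expEnd_smul_mul_expEnd_neg_smul h.sl2.nilX (1 / 2)
  rw [neg_neg] at e1
  have : (expEnd ((1 / 2 : ℂ) • X) * expEnd ((-1 : ℂ) • Y)) * cayley X Y = 1 := by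
    rw [cayley, mul_assoc, ← mul_assoc (expEnd ((-1 : ℂ) • Y)), e1, one_mul, e2]
  exact Function.LeftInverse.injective (g := expEnd ((1 / 2 : ℂ) • X) * expEnd ((-1 : ℂ) • Y))
    fun v => LinearMap.congr_fun this v

theorem cayley_surjective (h : IsSl2Bigraded n H X Y Vb) : Function.Surjective (cayley X Y) :=
  LinearMap.injective_iff_surjective.1 h.cayley_injective

theorem Vsharp_eq_map (h : IsSl2Bigraded n H X Y Vb) (p : ℤ) :
    Vsharp n Y Vb p = (⨆ ij ∈ {ij : ℤ × ℤ | ij.1 = p}, Vb ij.1 ij.2).map (cayley X Y) := by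
  have h1 : (totalF Vb p).map (expEnd Y) = (totalF Vb p).map (cayley X Y) := by
    rw [cayley, Module.End.mul_eq_comp, Submodule.map_comp,
      map_expEnd_smul_eq h.sl2.nilX (h.map_X_totalF p), one_smul]
  have h2 : (totalFbar Vb (n - p)).map (expEnd (-Y)) =
      (⨆ ij ∈ {ij : ℤ × ℤ | ij.1 ≤ p}, Vb ij.1 ij.2).map (cayley X Y) := by
    rw [← h.map_reflection (c := 2) (by norm_num) p, Module.End.mul_eq_comp, Submodule.map_comp,
      map_expEnd_smul_eq h.sl2.nilY (h.map_Y_biSup_le p), ← Submodule.map_comp,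
      ← Module.End.mul_eq_comp, ← mul_assoc, ← neg_one_smul ℂ Y,
      expEnd_smul_mul_expEnd_smul h.sl2.nilY, cayley]
    norm_num
  rw [Vsharp, h1, h2, ← Submodule.map_inf _ h.cayley_injective, totalF_eq_biSup,
    h.dec.biSup_inf_biSup]
  congr 3
  ext ij
  simp only [Set.mem_inter_iff, Set.mem_ofPred_eq]
  rw [show (p ≤ ij.1 ∧ ij.1 ≤ p) = (ij.1 = p) by ext; omega]

theorem induction_Vsharp (h : IsSl2Bigraded n H X Y Vb) {M N : Module.End ℂ V} {p : ℤ}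
    (hMN : ∀ j : ℤ, ∀ v ∈ Vb p j, M (cayley X Y v) = N (cayley X Y v)) :
    ∀ u ∈ Vsharp n Y Vb p, M u = N u := by
  rw [h.Vsharp_eq_map]
  rintro _ ⟨v, hv, rfl⟩
  have : (⨆ ij ∈ {ij : ℤ × ℤ | ij.1 = p}, Vb ij.1 ij.2) ≤
      LinearMap.eqLocus (M * cayley X Y) (N * cayley X Y) := by
    refine iSup₂_le ?_
    rintro ⟨i, j⟩ rfl v hv
    exact hMN j v hv
  exact this hv

/-- `(X + Y + T + n) / 2` acts on `V♯^p` as `p`, where `T` acts on `V^{i,j}` as `i - j`. -/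
theorem grading_apply (h : IsSl2Bigraded n H X Y Vb) {T : Module.End ℂ V}
    (hT : ∀ i j : ℤ, ∀ v ∈ Vb i j, T v = ((i - j : ℤ) : ℂ) • v) (p : ℤ) :
    ∀ u ∈ Vsharp n Y Vb p, (X + Y + T) u = ((2 * p - n : ℤ) : ℂ) • u := by
  refine h.induction_Vsharp (N := ((2 * p - n : ℤ) : ℂ) • 1) fun j v hv => ?_
  have e1 : T * cayley X Y = cayley X Y * T := by
    rw [cayley, ← mul_assoc, h.mul_exp_Y hT, mul_assoc, h.mul_exp_X hT, mul_assoc]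
  have e2 : (X + Y + T) * cayley X Y = cayley X Y * (H + T) := by
    rw [add_mul _ T, mul_add, e1, cayley, h.sl2.cayley_mul_H]
  rw [← Module.End.mul_apply, e2, Module.End.mul_apply, LinearMap.add_apply, hT p j v hv,
    h.H_apply p j v hv, ← add_smul, map_smul, LinearMap.smul_apply, Module.End.one_apply]
  congr 1
  push_cast
  ring

theorem iSup_Vsharp (h : IsSl2Bigraded n H X Y Vb) : ⨆ p, Vsharp n Y Vb p = ⊤ := by
  simp_rw [h.Vsharp_eq_map, ← Submodule.map_iSup]
  have : (⨆ p : ℤ, ⨆ ij ∈ {ij : ℤ × ℤ | ij.1 = p}, Vb ij.1 ij.2) = ⊤ := by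
    rw [eq_top_iff, ← h.dec.submodule_iSup_eq_top]
    exact iSup_le fun ij => le_iSup_of_le ij.1 (le_iSup₂_of_le ij rfl le_rfl)
  rw [this, Submodule.map_top, LinearMap.range_eq_top]
  exact h.cayley_surjective

theorem isInternal_Vsharp (h : IsSl2Bigraded n H X Y Vb) :
    DirectSum.IsInternal (fun p : ℤ => Vsharp n Y Vb p) := by
  refine DirectSum.isInternal_submodule_of_iSupIndep_of_iSup_eq_top ?_ h.iSup_Vsharp
  obtain ⟨T, hT⟩ := h.dec.exists_diagonal fun ij => ((ij.1 - ij.2 : ℤ) : ℂ)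
  have hinj : Function.Injective fun p : ℤ => ((2 * p - n : ℤ) : ℂ) := by
    intro a b hab
    have : 2 * a - n = 2 * b - n := Int.cast_injective hab
    omega
  refine ((Module.End.eigenspaces_iSupIndep (X + Y + T)).comp hinj).mono fun p u hu => ?_
  exact Module.End.mem_eigenspace_iff.2 (h.grading_apply (fun i j => hT (i, j)) p u hu)

section WeilOperator

variable {C : Module.End ℂ V} (hC : ∀ i j : ℤ, ∀ v ∈ Vb i j, C v = ((-1 : ℂ) ^ j) • v)

include hC

omit [FiniteDimensional ℂ V] in
theorem sign_mul_X (h : IsSl2Bigraded n H X Y Vb) : C * X = -(X * C) :=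
  h.end_ext fun i j v hv => by
    rw [Module.End.mul_apply, LinearMap.neg_apply, Module.End.mul_apply,
      hC _ _ _ (h.X_mem i j v hv), hC i j v hv, map_smul, zpow_add₀ (by norm_num)]
    simp

omit [FiniteDimensional ℂ V] in
theorem sign_mul_Y (h : IsSl2Bigraded n H X Y Vb) : C * Y = -(Y * C) :=
  h.end_ext fun i j v hv => by
    rw [Module.End.mul_apply, LinearMap.neg_apply, Module.End.mul_apply,
      hC _ _ _ (h.Y_mem i j v hv), hC i j v hv, map_smul, zpow_sub₀ (by norm_num)]
    simp [div_neg]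

omit [FiniteDimensional ℂ V] in
theorem sign_mul_sign (h : IsSl2Bigraded n H X Y Vb) : C * C = 1 :=
  h.end_ext fun i j v hv => by
    rw [Module.End.mul_apply, hC i j v hv, map_smul, hC i j v hv, smul_smul, ← mul_zpow]
    simp

theorem sign_mul_exp_X (h : IsSl2Bigraded n H X Y Vb) (a : ℂ) :
    C * expEnd (a • X) = expEnd ((-a) • X) * C :=
  mul_expEnd_of_semiconj (by
    rw [mul_smul_comm, h.sign_mul_X hC, smul_mul_assoc, smul_neg, neg_smul])

theorem sign_mul_exp_Y (h : IsSl2Bigraded n H X Y Vb) (a : ℂ) :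
    C * expEnd (a • Y) = expEnd ((-a) • Y) * C :=
  mul_expEnd_of_semiconj (by
    rw [mul_smul_comm, h.sign_mul_Y hC, smul_mul_assoc, smul_neg, neg_smul])

/-- The operator `w C` is an involution. -/
theorem weil_sign_mul_self (h : IsSl2Bigraded n H X Y Vb) :
    (weil X Y * C) * (weil X Y * C) = 1 := by
  have e1 := expEnd_smul_mul_expEnd_neg_smul h.sl2.nilX 1
  have e2 := expEnd_smul_mul_expEnd_neg_smul h.sl2.nilY (-1)
  have hCw : C * weil X Y =
      expEnd ((-1 : ℂ) • X) * expEnd ((-(-1) : ℂ) • Y) * expEnd ((-1 : ℂ) • X) * C := by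
    rw [IsNilpotentSl2.weil_eq, ← mul_assoc, ← mul_assoc, h.sign_mul_exp_X hC,
      mul_assoc _ C, h.sign_mul_exp_Y hC, ← mul_assoc, mul_assoc _ C, h.sign_mul_exp_X hC,
      mul_assoc, mul_assoc, mul_assoc]
  rw [mul_assoc, ← mul_assoc C, hCw, mul_assoc _ C, h.sign_mul_sign hC, mul_one,
    IsNilpotentSl2.weil_eq]
  calc _ = expEnd ((1 : ℂ) • X) * (expEnd ((-1 : ℂ) • Y) * ((expEnd ((1 : ℂ) • X) *
        expEnd ((-1 : ℂ) • X)) * expEnd ((-(-1) : ℂ) • Y))) * expEnd ((-1 : ℂ) • X) := by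
        simp only [mul_assoc]
    _ = 1 := by rw [e1, one_mul, e2, mul_one, e1]

theorem weil_sign_mul_X (h : IsSl2Bigraded n H X Y Vb) :
    (weil X Y * C) * X = Y * (weil X Y * C) := by
  rw [mul_assoc, h.sign_mul_X hC, mul_neg, ← mul_assoc, h.sl2.weil_mul_X, neg_mul, neg_neg,
    mul_assoc]

theorem weil_sign_mul_Y (h : IsSl2Bigraded n H X Y Vb) :
    (weil X Y * C) * Y = X * (weil X Y * C) := by
  set R := weil X Y * C with hR
  have h1 : R * R = 1 := h.weil_sign_mul_self hC
  have h2 : R * X = Y * R := h.weil_sign_mul_X hC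
  calc R * Y = R * (Y * R) * R := by rw [mul_assoc R, mul_assoc Y, h1, mul_one]
    _ = (R * R) * X * R := by rw [← h2]; simp only [mul_assoc]
    _ = X * R := by rw [h1, one_mul]

theorem weil_sign_mul_H (h : IsSl2Bigraded n H X Y Vb) :
    (weil X Y * C) * H = -(H * (weil X Y * C)) :=
  h.end_ext fun i j v hv => by
    rw [Module.End.mul_apply, LinearMap.neg_apply, Module.End.mul_apply, Module.End.mul_apply,
      h.H_apply i j v hv, map_smul, map_smul, Module.End.mul_apply, hC i j v hv, map_smul,
      map_smul, h.H_apply _ _ _ (h.weil_mem hv), smul_comm, ← smul_neg, ← neg_smul]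
    congr 2
    push_cast
    ring

/-- The operator `w C` acts on `V♯^p` as `(-1)^(n - p)`. -/
theorem weil_sign_apply (h : IsSl2Bigraded n H X Y Vb) (p : ℤ) :
    ∀ u ∈ Vsharp n Y Vb p, (weil X Y * C) u = ((-1 : ℂ) ^ (n - p)) • u := by
  refine h.induction_Vsharp (N := ((-1 : ℂ) ^ (n - p)) • 1) fun j v hv => ?_
  set R := weil X Y * C with hR
  have hRR : R * R = 1 := h.weil_sign_mul_self hC
  have hRC : R * C = weil X Y := by rw [hR, mul_assoc, h.sign_mul_sign hC, mul_one]
  have hRX : ∀ a : ℂ, R * expEnd (a • X) = expEnd (a • Y) * R := fun a =>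
    mul_expEnd_of_semiconj (by
      rw [mul_smul_comm, h.weil_sign_mul_X hC, smul_mul_assoc])
  have hRY : ∀ a : ℂ, R * expEnd (a • Y) = expEnd (a • X) * R := fun a =>
    mul_expEnd_of_semiconj (by
      rw [mul_smul_comm, h.weil_sign_mul_Y hC, smul_mul_assoc])
  have hX : expEnd ((1 : ℂ) • X) = expEnd ((1 : ℂ) • Y) * weil X Y * expEnd ((1 : ℂ) • Y) := by
    have e1 := expEnd_smul_mul_expEnd_neg_smul h.sl2.nilY 1
    have e2 := expEnd_smul_mul_expEnd_neg_smul h.sl2.nilY (-1)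
    rw [neg_neg] at e2
    rw [h.sl2.weil_eq', mul_assoc, mul_assoc, e2, mul_one, ← mul_assoc, e1, one_mul]
  have key : R * cayley X Y = cayley X Y * (R * (C * R)) := by
    have e := expEnd_smul_mul_expEnd_smul h.sl2.nilY 1 (-(1 / 2))
    calc R * cayley X Y
        = expEnd ((1 : ℂ) • X) * (expEnd ((-(1 / 2) : ℂ) • Y) * R) := by
          rw [cayley, ← mul_assoc, hRY, mul_assoc, hRX]
      _ = expEnd ((1 : ℂ) • Y) * (R * (C * (expEnd ((1 - 1 / 2 : ℂ) • Y) * R))) := by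
          rw [hX, mul_assoc, ← mul_assoc (expEnd ((1 : ℂ) • Y)) (expEnd _) R, e, ← hRC]
          simp only [mul_assoc, sub_eq_add_neg]
      _ = expEnd ((1 : ℂ) • Y) * (R * expEnd ((-(1 - 1 / 2) : ℂ) • Y) * (C * R)) := by
          rw [← mul_assoc C, h.sign_mul_exp_Y hC]
          simp only [mul_assoc]
      _ = _ := by
          rw [hRY, cayley]
          norm_num [mul_assoc]
  have hRv : C (R v) = ((-1 : ℂ) ^ (n - p)) • R v := by
    apply hC (n - j)
    rw [hR, Module.End.mul_apply, hC p j v hv, map_smul]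
    exact Submodule.smul_mem _ _ (h.weil_mem hv)
  have hRRv : R (R v) = v := LinearMap.congr_fun hRR v
  change (R * cayley X Y) v = _
  rw [key]
  change cayley X Y (R (C (R v))) = _
  rw [hRv, map_smul, hRRv, map_smul]
  simp

end WeilOperator

end IsSl2Bigraded

end BigradedSl2

theorem sl2_hodge_associated_hodge_structure
    {V : Type*} [AddCommGroup V] [Module ℂ V] [FiniteDimensional ℂ V]
    (n : ℤ) (H X Y : V →ₗ[ℂ] V)
    -- the sl₂-relations
    (hHX : H ∘ₗ X - X ∘ₗ H = (2 : ℂ) • X)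
    (hHY : H ∘ₗ Y - Y ∘ₗ H = (-2 : ℂ) • Y)
    (hXY : X ∘ₗ Y - Y ∘ₗ X = H)
    -- the bigrading `V = ⊕_{i,j} V^{i,j}`
    (Vb : ℤ → ℤ → Submodule ℂ V)
    (hdec : DirectSum.IsInternal (fun ij : ℤ × ℤ => Vb ij.1 ij.2))
    (hH : ∀ i j : ℤ, ∀ v ∈ Vb i j, H v = ((i + j - n : ℤ) : ℂ) • v)
    (hX : ∀ i j : ℤ, Submodule.map X (Vb i j) ≤ Vb (i + 1) (j + 1))
    (hY : ∀ i j : ℤ, Submodule.map Y (Vb i j) ≤ Vb (i - 1) (j - 1))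
    -- the polarization `Q`
    (Q : V →ₗ[ℂ] V →ₛₗ[starRingEnd ℂ] ℂ)
    (hherm : ∀ v w : V, Q w v = starRingEnd ℂ (Q v w))
    (hnd : ∀ v : V, (∀ w : V, Q v w = 0) → v = 0)
    (hQH : ∀ v w : V, Q (H v) w = -Q v (H w))
    (hQX : ∀ v w : V, Q (X v) w = Q v (X w))
    (hQY : ∀ v w : V, Q (Y v) w = Q v (Y w))
    -- `Q(·, w·)` polarizes the weight-(n+k) Hodge structure on each weight space
    (hpolorth : ∀ i j i' j' : ℤ, i + j = i' + j' → (i, j) ≠ (i', j') →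
      ∀ v ∈ Vb i j, ∀ v' ∈ Vb i' j', Q v (weil X Y v') = 0)
    (hpolpos : ∀ i j : ℤ, ∀ v ∈ Vb i j, v ≠ 0 → posC ((-1 : ℂ) ^ j * Q v (weil X Y v))) :
    -- (a) `V = ⊕_p V♯^{p, n−p}` is a Hodge structure of weight `n` polarized by `Q`
    DirectSum.IsInternal (fun p : ℤ => Vsharp n Y Vb p) ∧
    (∀ p p' : ℤ, p ≠ p' → ∀ v ∈ Vsharp n Y Vb p, ∀ v' ∈ Vsharp n Y Vb p', Q v v' = 0) ∧
    (∀ p : ℤ, ∀ v ∈ Vsharp n Y Vb p, v ≠ 0 → posC ((-1 : ℂ) ^ (n - p) * Q v v)) ∧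
    -- let `C♯` be the Weil operator of this Hodge structure, so that its inner product
    -- is `(v, v') ↦ Q(v, C♯ v')`; then (b) and (c) hold:
    (∀ Cs : V →ₗ[ℂ] V, (∀ p : ℤ, ∀ u ∈ Vsharp n Y Vb p, Cs u = ((-1 : ℂ) ^ (n - p)) • u) →
      -- (b) the inner product equals the sl₂ inner product
      -- `⟨v,v'⟩ = Σ (−1)^q Q(v^{p,q}, w(v'^{p,q}))`, evaluated on the bigraded pieces
      ((∀ i j i' j' : ℤ, ∀ v v' : V, v ∈ Vb i j → v' ∈ Vb i' j' →
        Q v (Cs v') = if i = i' ∧ j = j' then ((-1 : ℂ) ^ j) * Q v (weil X Y v') else 0) ∧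
      -- (c) `H` is self-adjoint and the adjoint of `Y` is `X`
      (∀ v v' : V, Q (H v) (Cs v') = Q v (Cs (H v'))) ∧
      (∀ v v' : V, Q (Y v) (Cs v') = Q v (Cs (X v'))))) := by
  have hX' : ∀ i j : ℤ, ∀ v ∈ Vb i j, X v ∈ Vb (i + 1) (j + 1) := fun i j v hv =>
    hX i j (Submodule.mem_map_of_mem hv)
  have hY' : ∀ i j : ℤ, ∀ v ∈ Vb i j, Y v ∈ Vb (i - 1) (j - 1) := fun i j v hv =>
    hY i j (Submodule.mem_map_of_mem hv)
  have h : IsSl2Bigraded n H X Y Vb :=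
    { sl2 :=
        { hX := by
            have : H * X - X * H = (2 : ℂ) • X := hHX
            rw [neg_smul, ← this]; abel
          hY := by
            have : H * Y - Y * H = (-2 : ℂ) • Y := hHY
            rw [show (2 : ℂ) • Y = -((-2 : ℂ) • Y) by module, ← this]; abel
          xy := by
            have : X * Y - Y * X = H := hXY
            rw [← this]; abel
          nilX := isNilpotent_of_shift hdec one_ne_zero hX'
          nilY := isNilpotent_of_shift hdec (neg_ne_zero.2 one_ne_zero) hY' }
      dec := hdec
      H_apply := hH
      X_mem := hX'
      Y_mem := hY' }
  obtain ⟨C, hC'⟩ := hdec.exists_diagonal fun ij => (-1 : ℂ) ^ ij.2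
  have hC : ∀ i j : ℤ, ∀ v ∈ Vb i j, C v = ((-1 : ℂ) ^ j) • v := fun i j => hC' (i, j)
  obtain ⟨T, hT'⟩ := hdec.exists_diagonal fun ij => ((ij.1 - ij.2 : ℤ) : ℂ)
  have hT : ∀ i j : ℤ, ∀ v ∈ Vb i j, T v = ((i - j : ℤ) : ℂ) • v := fun i j => hT' (i, j)
  obtain ⟨R, hR⟩ : ∃ R : Module.End ℂ V, R = weil X Y * C := ⟨_, rfl⟩
  have hRsharp : ∀ p : ℤ, ∀ u ∈ Vsharp n Y Vb p, R u = ((-1 : ℂ) ^ (n - p)) • u :=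
    hR ▸ h.weil_sign_apply hC
  have hRR : ∀ v, R (R v) = v := by
    rw [hR]
    exact LinearMap.congr_fun (h.weil_sign_mul_self hC)
  have hconj : ∀ m : ℤ, starRingEnd ℂ ((-1 : ℂ) ^ m) = (-1 : ℂ) ^ m := fun m => by simp
  have hb : ∀ i j i' j' : ℤ, ∀ v v' : V, v ∈ Vb i j → v' ∈ Vb i' j' →
      Q v (R v') = if i = i' ∧ j = j' then ((-1 : ℂ) ^ j) * Q v (weil X Y v') else 0 := by
    intro i j i' j' v v' hv hv'
    have e : Q v (R v') = (-1 : ℂ) ^ j' * Q v (weil X Y v') := by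
      rw [hR, Module.End.mul_apply, hC _ _ _ hv', map_smul, map_smulₛₗ, hconj, smul_eq_mul]
    rw [e]
    split_ifs with hij
    · rw [hij.2]
    · rw [mul_eq_zero]
      right
      by_cases hsum : i + j = i' + j'
      · exact hpolorth i j i' j' hsum (fun heq => hij (by simpa using heq)) v hv v' hv'
      · have e1 := hQH v (weil X Y v')
        rw [hH i j v hv, hH _ _ _ (h.weil_mem hv'), map_smul, LinearMap.smul_apply, map_smulₛₗ,
          map_intCast, smul_eq_mul, smul_eq_mul, ← neg_mul, ← sub_eq_zero, ← sub_mul,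
          mul_eq_zero] at e1
        refine e1.resolve_left fun h0 => hsum ?_
        have : i + j - n - -(n - j' + (n - i') - n) = 0 := by exact_mod_cast h0
        omega
  have hTself : ∀ v v' : V, Q (T v) (R v') = Q v (R (T v')) := by
    intro v v'
    induction v using h.dec.induction with
    | zero => simp
    | add v w hv hw => simp only [map_add, LinearMap.add_apply, hv, hw]
    | mem ij v hv =>
      induction v' using h.dec.induction with
      | zero => simp
      | add v' w' hv' hw' => simp only [map_add, hv', hw']
      | mem ij' v' hv' =>
        rw [hT _ _ v hv, hT _ _ v' hv', map_smul, map_smul, LinearMap.smul_apply, map_smulₛₗ,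
          map_intCast, hb _ _ _ _ v v' hv hv']
        split_ifs with hij
        · rw [hij.1, hij.2]
        · simp
  have hpos : ∀ v : V, v ≠ 0 → posC (Q v (R v)) := by
    intro v hv
    classical
    let _ := hdec.chooseDecomposition
    set d := DirectSum.decompose (fun ij : ℤ × ℤ => Vb ij.1 ij.2) v with hd
    have hsum : ∑ a ∈ d.support, (d a : V) = v := DirectSum.sum_support_decompose _ v
    have e : Q v (R v) = ∑ a ∈ d.support, Q (d a) (R (d a)) := by
      conv_lhs => rw [← hsum]
      rw [map_sum, map_sum, LinearMap.sum_apply]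
      refine Finset.sum_congr rfl fun a ha => ?_
      rw [map_sum]
      refine Finset.sum_eq_single_of_mem a ha fun b _ hba => ?_
      rw [hb _ _ _ _ _ _ (d a).2 (d b).2, if_neg]
      exact fun hab => hba (Prod.ext hab.1.symm hab.2.symm)
    have hterm : ∀ a ∈ d.support, 0 < (Q (d a) (R (d a))).re ∧ (Q (d a) (R (d a))).im = 0 := by
      intro a ha
      rw [hb _ _ _ _ _ _ (d a).2 (d a).2, if_pos ⟨rfl, rfl⟩]
      have := hpolpos _ _ _ (d a).2 (by simpa using ha)
      exact ⟨this.2, this.1⟩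
    have hne : d.support.Nonempty := by
      rw [Finset.nonempty_iff_ne_empty]
      intro h0
      rw [h0, Finset.sum_empty] at hsum
      exact hv hsum.symm
    rw [e, posC, Complex.im_sum, Complex.re_sum]
    exact ⟨Finset.sum_eq_zero fun a ha => (hterm a ha).2,
      Finset.sum_pos (fun a ha => (hterm a ha).1) hne⟩
  have hsharp : ∀ p : ℤ, ∀ v : V, ∀ v' ∈ Vsharp n Y Vb p,
      Q v (R v') = (-1 : ℂ) ^ (n - p) * Q v v' := by
    intro p v v' hv'
    rw [hRsharp p v' hv', map_smulₛₗ, hconj, smul_eq_mul]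
  refine ⟨h.isInternal_Vsharp, ?_, ?_, ?_⟩
  · intro p p' hpp v hv v' hv'
    have hZ : Q ((X + Y + T) v) v' = Q v ((X + Y + T) v') := by
      have hTQ : Q (T v) v' = Q v (T v') := by
        have hcomm : T * R = R * T := h.end_ext fun i j u hu => by
          rw [Module.End.mul_apply, Module.End.mul_apply, hT i j u hu, map_smul, hR,
            Module.End.mul_apply, hC i j u hu, map_smul, map_smul, hT _ _ _ (h.weil_mem hu),
            sub_sub_sub_cancel_left, smul_comm]
        have := hTself v (R v')
        rw [hRR] at this
        rw [this, ← Module.End.mul_apply T, hcomm, Module.End.mul_apply, hRR]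
      simp only [LinearMap.add_apply, map_add, hQX, hQY, hTQ]
    rw [h.grading_apply hT p v hv, h.grading_apply hT p' v' hv', map_smul, LinearMap.smul_apply,
      map_smulₛₗ, map_intCast, smul_eq_mul, smul_eq_mul, ← sub_eq_zero, ← sub_mul,
      mul_eq_zero] at hZ
    refine hZ.resolve_left fun h0 => hpp ?_
    have : 2 * p - n - (2 * p' - n) = 0 := by exact_mod_cast h0
    omega
  · intro p v hv hv0
    rw [← hsharp p v v hv]
    exact hpos v hv0
  · intro Cs hCs
    have hCsR : Cs = R := h.isInternal_Vsharp.linearMap_ext fun p u hu => by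
      rw [hCs p u hu, hRsharp p u hu]
    rw [hCsR]
    refine ⟨hb, fun v v' => ?_, fun v v' => ?_⟩
    · have hRH : R * H = -(H * R) := hR ▸ h.weil_sign_mul_H hC
      have := LinearMap.congr_fun hRH v'
      change R (H v') = -(H (R v')) at this
      rw [hQH, this, map_neg]
    · have hRX : R * X = Y * R := hR ▸ h.weil_sign_mul_X hC
      have := LinearMap.congr_fun hRX v'
      change R (X v') = Y (R v') at this
      rw [hQY, this]
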